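/- Let A ≥ 1 and let (X,d) be an unbounded A-uniform metric space with d(x) > 0 for every x ∈ X, and let k be its quasihyperbolic metric. Then there exist constants B ≥ 1 and C ≥ 0 depending only on A such that for all points x, y, z, u ∈ X satisfying max(d(x,y), d(x,z)) ≤ (1/2)·d(x,u) and 0 < (1/2)·d(x,z) ≤ d(x,y), one has (x|z)^k_u − (x|y)^k_u ≤ 4A²·log(1 + 6B·d(x,y)/d(x,z)) + C. -/

import Mathlib

open Metric Filter Set

noncomputable section

universe u v

/-- Gromov product of `x` and `y` with respect to base point `w`,
for a real-valued distance kernel `ρ`. -/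
def gromovProd {X : Type u} (ρ : X → X → ℝ) (w x y : X) : ℝ :=
  (ρ x w + ρ y w - ρ x y) / 2

/-- `(X, ρ)` is δ-hyperbolic. -/
def IsDeltaHyp {X : Type u} (ρ : X → X → ℝ) (δ : ℝ) : Prop :=
  ∀ x y z w : X, gromovProd ρ w x y ≥ min (gromovProd ρ w x z) (gromovProd ρ w z y) - δ

/-- `f` is a (λ,μ)-rough similarity. -/
def RoughSimilarity {X : Type u} {Y : Type v} [MetricSpace X] [MetricSpace Y]
    (lam mu : ℝ) (f : X → Y) : Prop :=
  (∀ y : Y, ∃ x : X, dist y (f x) ≤ mu) ∧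
  (∀ x x' : X, lam * dist x x' - mu ≤ dist (f x) (f x') ∧
    dist (f x) (f x') ≤ lam * dist x x' + mu)

/-- The distance from `x ∈ X` to the metric boundary `∂X = X̄ \ X`. -/
def distToBdry (X : Type u) [MetricSpace X] (x : X) : ℝ :=
  Metric.infDist (x : UniformSpace.Completion X)
    (Set.range ((↑) : X → UniformSpace.Completion X))ᶜ

/-- `X` is noncomplete, i.e. `∂X = X̄ \ X ≠ ∅`. -/
def IsNoncomplete (X : Type u) [MetricSpace X] : Prop :=
  ((Set.range ((↑) : X → UniformSpace.Completion X))ᶜ).Nonempty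

/-- Ibragimov's hyperbolization metric. -/
def hMetric (X : Type u) [MetricSpace X] (x y : X) : ℝ :=
  2 * Real.log ((dist x y + max (distToBdry X x) (distToBdry X y)) /
    Real.sqrt (distToBdry X x * distToBdry X y))

/-- The j̃-metric. -/
def jtMetric (X : Type u) [MetricSpace X] (x y : X) : ℝ :=
  (1 / 2) * Real.log ((1 + dist x y / distToBdry X x) * (1 + dist x y / distToBdry X y))

/-- The quasihyperbolic metric. -/
def quasihyperbolic (X : Type u) [MetricSpace X] (x y : X) : ℝ :=
  sInf {r : ℝ | ∃ L : ℝ, 0 ≤ L ∧ ∃ γ : ℝ → X,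
    LipschitzOnWith 1 γ (Set.Icc 0 L) ∧ γ 0 = x ∧ γ L = y ∧
    r = ∫ t in (0:ℝ)..L, (distToBdry X (γ t))⁻¹}

/-- `X` is an `A`-uniform metric space. -/
def IsUniformMS (X : Type u) [MetricSpace X] (A : ℝ) : Prop :=
  ∀ x y : X, ∃ L : ℝ, 0 ≤ L ∧ ∃ γ : ℝ → X,
    LipschitzOnWith 1 γ (Set.Icc 0 L) ∧ γ 0 = x ∧ γ L = y ∧
    L ≤ A * dist x y ∧ ∀ t ∈ Set.Icc (0:ℝ) L, min t (L - t) ≤ A * distToBdry X (γ t)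

/-- `X` is unbounded. -/
def IsUnbounded (X : Type u) [MetricSpace X] : Prop :=
  ¬ Bornology.IsBounded (Set.univ : Set X)

section QuasihyperbolicMetric

variable {X : Type u} [MetricSpace X]

lemma distToBdry_le_add_dist (x y : X) :
    distToBdry X x ≤ distToBdry X y + dist x y := by
  have h := Metric.infDist_le_infDist_add_dist (x := (x : UniformSpace.Completion X))
    (y := (y : UniformSpace.Completion X))
    (s := (Set.range ((↑) : X → UniformSpace.Completion X))ᶜ)
  rwa [UniformSpace.Completion.dist_eq] at h

lemma continuous_distToBdry : Continuous (distToBdry X) :=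
  (Metric.continuous_infDist_pt _).comp (UniformSpace.Completion.continuous_coe X)

lemma dist_le_of_lipschitzOnWith_one {γ : ℝ → X} {L s t : ℝ}
    (hγ : LipschitzOnWith 1 γ (Icc 0 L)) (hs : 0 ≤ s) (hst : s ≤ t) (ht : t ≤ L) :
    dist (γ s) (γ t) ≤ t - s := by
  have h := hγ.dist_le_mul s ⟨hs, hst.trans ht⟩ t ⟨hs.trans hst, ht⟩
  rw [Real.dist_eq, abs_sub_comm, abs_of_nonneg (sub_nonneg.2 hst)] at h
  simpa using h

lemma intervalIntegrable_inv_distToBdry (hpos : ∀ x : X, 0 < distToBdry X x)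
    {γ : ℝ → X} {L s t : ℝ} (hγ : LipschitzOnWith 1 γ (Icc 0 L))
    (hs : s ∈ Icc 0 L) (ht : t ∈ Icc 0 L) :
    IntervalIntegrable (fun t => (distToBdry X (γ t))⁻¹) MeasureTheory.volume s t := by
  refine ContinuousOn.intervalIntegrable ?_
  refine ContinuousOn.mono ?_ (ordConnected_Icc.uIcc_subset hs ht)
  exact (continuous_distToBdry.comp_continuousOn hγ.continuousOn).inv₀ fun x _ => (hpos _).ne'

lemma quasihyperbolic_le_of_curve (hpos : ∀ x : X, 0 < distToBdry X x)
    {γ : ℝ → X} {L : ℝ} (hL : 0 ≤ L) (hγ : LipschitzOnWith 1 γ (Icc 0 L)) :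
    quasihyperbolic X (γ 0) (γ L) ≤ ∫ t in (0:ℝ)..L, (distToBdry X (γ t))⁻¹ := by
  refine csInf_le ⟨0, ?_⟩ ⟨L, hL, γ, hγ, rfl, rfl, rfl⟩
  rintro r ⟨L', hL', γ', -, -, -, rfl⟩
  exact intervalIntegral.integral_nonneg hL' fun t _ => (inv_pos.2 (hpos _)).le

lemma quasihyperbolic_le_integral (hpos : ∀ x : X, 0 < distToBdry X x)
    {γ : ℝ → X} {L s t : ℝ} (hγ : LipschitzOnWith 1 γ (Icc 0 L))
    (hs : 0 ≤ s) (hst : s ≤ t) (ht : t ≤ L) :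
    quasihyperbolic X (γ s) (γ t) ≤ ∫ r in s..t, (distToBdry X (γ r))⁻¹ := by
  have hγ' : LipschitzOnWith 1 (fun r => γ (r + s)) (Icc 0 (t - s)) := by
    refine LipschitzOnWith.of_dist_le_mul fun a ha b hb => ?_
    have := hγ.dist_le_mul (a + s) ⟨by linarith [ha.1], by linarith [ha.2]⟩
      (b + s) ⟨by linarith [hb.1], by linarith [hb.2]⟩
    simpa using this
  have h := quasihyperbolic_le_of_curve hpos (sub_nonneg.2 hst) hγ'
  have e := intervalIntegral.integral_comp_add_right
    (a := 0) (b := t - s) (fun r => (distToBdry X (γ r))⁻¹) s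
  simp only [zero_add, sub_add_cancel] at h e
  rwa [e] at h

lemma exists_curve_integral_lt {A : ℝ} (hunif : IsUniformMS X A) (x y : X) {ε : ℝ}
    (hε : 0 < ε) :
    ∃ L : ℝ, 0 ≤ L ∧ ∃ γ : ℝ → X, LipschitzOnWith 1 γ (Icc 0 L) ∧ γ 0 = x ∧ γ L = y ∧
      ∫ t in (0:ℝ)..L, (distToBdry X (γ t))⁻¹ < quasihyperbolic X x y + ε := by
  obtain ⟨L₀, hL₀, γ₀, hγ₀, hx₀, hy₀, -⟩ := hunif x y
  obtain ⟨r, ⟨L, hL, γ, hγ, hx, hy, rfl⟩, hr⟩ := exists_lt_of_csInf_lt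
    (s := {r : ℝ | ∃ L : ℝ, 0 ≤ L ∧ ∃ γ : ℝ → X,
      LipschitzOnWith 1 γ (Set.Icc 0 L) ∧ γ 0 = x ∧ γ L = y ∧
      r = ∫ t in (0:ℝ)..L, (distToBdry X (γ t))⁻¹})
    ⟨_, L₀, hL₀, γ₀, hγ₀, hx₀, hy₀, rfl⟩ (lt_add_of_pos_right (quasihyperbolic X x y) hε)
  exact ⟨L, hL, γ, hγ, hx, hy, hr⟩

lemma LipschitzOnWith.comp_const_sub {γ : ℝ → X} {L : ℝ}
    (hγ : LipschitzOnWith 1 γ (Icc 0 L)) :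
    LipschitzOnWith 1 (fun t => γ (L - t)) (Icc 0 L) := by
  refine LipschitzOnWith.of_dist_le_mul fun a ha b hb => ?_
  have := hγ.dist_le_mul (L - a) ⟨by linarith [ha.2], by linarith [ha.1]⟩
    (L - b) ⟨by linarith [hb.2], by linarith [hb.1]⟩
  rwa [dist_sub_left] at this

lemma quasihyperbolic_comm_le (hpos : ∀ x : X, 0 < distToBdry X x) {A : ℝ}
    (hunif : IsUniformMS X A) (x y : X) :
    quasihyperbolic X y x ≤ quasihyperbolic X x y := by
  refine le_of_forall_pos_le_add fun ε hε => ?_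
  obtain ⟨L, hL, γ, hγ, rfl, rfl, hlt⟩ := exists_curve_integral_lt hunif x y hε
  have h := quasihyperbolic_le_of_curve hpos hL hγ.comp_const_sub
  rw [intervalIntegral.integral_comp_sub_left (fun r => (distToBdry X (γ r))⁻¹)] at h
  simp only [sub_zero, sub_self] at h
  exact h.trans hlt.le

lemma quasihyperbolic_comm (hpos : ∀ x : X, 0 < distToBdry X x) {A : ℝ}
    (hunif : IsUniformMS X A) (x y : X) :
    quasihyperbolic X x y = quasihyperbolic X y x :=
  le_antisymm (quasihyperbolic_comm_le hpos hunif _ _) (quasihyperbolic_comm_le hpos hunif _ _)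

lemma lipschitzOnWith_one_concat {γ₁ γ₂ : ℝ → X} {L₁ L₂ : ℝ}
    (h₁ : LipschitzOnWith 1 γ₁ (Icc 0 L₁)) (h₂ : LipschitzOnWith 1 γ₂ (Icc 0 L₂))
    (h : γ₁ L₁ = γ₂ 0) :
    LipschitzOnWith 1 (fun t => if t ≤ L₁ then γ₁ t else γ₂ (t - L₁)) (Icc 0 (L₁ + L₂)) := by
  have key : ∀ a ∈ Icc 0 (L₁ + L₂), ∀ b ∈ Icc 0 (L₁ + L₂), a ≤ b →
      dist (if a ≤ L₁ then γ₁ a else γ₂ (a - L₁)) (if b ≤ L₁ then γ₁ b else γ₂ (b - L₁))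
        ≤ b - a := by
    intro a ha b hb hab
    by_cases hb' : b ≤ L₁
    · rw [if_pos (hab.trans hb'), if_pos hb']
      exact dist_le_of_lipschitzOnWith_one h₁ ha.1 hab hb'
    · rw [if_neg hb']
      push Not at hb'
      by_cases ha' : a ≤ L₁
      · rw [if_pos ha']
        have e₁ := dist_le_of_lipschitzOnWith_one h₁ ha.1 ha' le_rfl
        have e₂ := dist_le_of_lipschitzOnWith_one h₂ (s := 0) (t := b - L₁) le_rfl
          (by linarith) (by linarith [hb.2])
        rw [← h] at e₂
        linarith [dist_triangle (γ₁ a) (γ₁ L₁) (γ₂ (b - L₁))]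
      · rw [if_neg ha']
        push Not at ha'
        have e := dist_le_of_lipschitzOnWith_one h₂ (s := a - L₁) (t := b - L₁) (by linarith)
          (by linarith) (by linarith [hb.2])
        linarith
  refine LipschitzOnWith.of_dist_le_mul fun a ha b hb => ?_
  rw [NNReal.coe_one, one_mul, Real.dist_eq]
  rcases le_total a b with hab | hab
  · rw [abs_sub_comm, abs_of_nonneg (sub_nonneg.2 hab)]
    exact key a ha b hb hab
  · rw [abs_of_nonneg (sub_nonneg.2 hab), dist_comm]
    exact key b hb a ha hab

lemma quasihyperbolic_triangle (hpos : ∀ x : X, 0 < distToBdry X x) {A : ℝ}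
    (hunif : IsUniformMS X A) (x y z : X) :
    quasihyperbolic X x z ≤ quasihyperbolic X x y + quasihyperbolic X y z := by
  refine le_of_forall_pos_le_add fun ε hε => ?_
  obtain ⟨L₁, hL₁, γ₁, hγ₁, rfl, rfl, hlt₁⟩ := exists_curve_integral_lt hunif x y (half_pos hε)
  obtain ⟨L₂, hL₂, γ₂, hγ₂, hy, rfl, hlt₂⟩ :=
    exists_curve_integral_lt hunif (γ₁ L₁) z (half_pos hε)
  have hlip := lipschitzOnWith_one_concat hγ₁ hγ₂ hy.symm
  set γ : ℝ → X := fun t => if t ≤ L₁ then γ₁ t else γ₂ (t - L₁) with hγdef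
  have hγ_left : ∀ t, t ≤ L₁ → γ t = γ₁ t := fun t ht => if_pos ht
  have hγ_right : ∀ t, L₁ ≤ t → γ t = γ₂ (t - L₁) := by
    intro t ht
    rcases ht.eq_or_lt with rfl | ht
    · rw [hγ_left _ le_rfl, sub_self, hy]
    · exact if_neg ht.not_ge
  have hle := quasihyperbolic_le_of_curve hpos (add_nonneg hL₁ hL₂) hlip
  have hsplit := intervalIntegral.integral_add_adjacent_intervals
    (intervalIntegrable_inv_distToBdry hpos hlip (s := 0) (t := L₁)
      ⟨le_rfl, by linarith⟩ ⟨hL₁, by linarith⟩)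
    (intervalIntegrable_inv_distToBdry hpos hlip (s := L₁) (t := L₁ + L₂)
      ⟨hL₁, by linarith⟩ ⟨by linarith, le_rfl⟩)
  have e₁ : ∫ t in (0:ℝ)..L₁, (distToBdry X (γ t))⁻¹ =
      ∫ t in (0:ℝ)..L₁, (distToBdry X (γ₁ t))⁻¹ := by
    refine intervalIntegral.integral_congr fun t ht => ?_
    rw [uIcc_of_le hL₁] at ht
    simp only [hγ_left t ht.2]
  have e₂ : ∫ t in L₁..(L₁ + L₂), (distToBdry X (γ t))⁻¹ =
      ∫ t in (0:ℝ)..L₂, (distToBdry X (γ₂ t))⁻¹ := by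
    have : ∫ t in L₁..(L₁ + L₂), (distToBdry X (γ t))⁻¹ =
        ∫ t in L₁..(L₁ + L₂), (distToBdry X (γ₂ (t - L₁)))⁻¹ := by
      refine intervalIntegral.integral_congr fun t ht => ?_
      rw [uIcc_of_le (by linarith)] at ht
      simp only [hγ_right t ht.1]
    rw [this, intervalIntegral.integral_comp_sub_right (fun r => (distToBdry X (γ₂ r))⁻¹)]
    simp
  rw [hγ_left 0 hL₁, hγ_right (L₁ + L₂) (by linarith), add_sub_cancel_left] at hle
  linarith

/-- A `1`-Lipschitz curve on `[0, L]` all of whose subcurves have quasihyperbolic length within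
`1` of the quasihyperbolic distance of their endpoints. -/
def IsNearGeodesic (γ : ℝ → X) (L : ℝ) : Prop :=
  LipschitzOnWith 1 γ (Icc 0 L) ∧ ∀ s t : ℝ, 0 ≤ s → s ≤ t → t ≤ L →
    ∫ r in s..t, (distToBdry X (γ r))⁻¹ ≤ quasihyperbolic X (γ s) (γ t) + 1

lemma exists_isNearGeodesic (hpos : ∀ x : X, 0 < distToBdry X x) {A : ℝ}
    (hunif : IsUniformMS X A) (x y : X) :
    ∃ L : ℝ, 0 ≤ L ∧ ∃ γ : ℝ → X, IsNearGeodesic γ L ∧ γ 0 = x ∧ γ L = y := by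
  obtain ⟨L, hL, γ, hγ, rfl, rfl, hlt⟩ := exists_curve_integral_lt hunif x y one_pos
  refine ⟨L, hL, γ, ⟨hγ, fun s t hs hst ht => ?_⟩, rfl, rfl⟩
  have i : ∀ {a b : ℝ}, a ∈ Icc 0 L → b ∈ Icc 0 L → IntervalIntegrable
      (fun t => (distToBdry X (γ t))⁻¹) MeasureTheory.volume a b :=
    fun ha hb => intervalIntegrable_inv_distToBdry hpos hγ ha hb
  have m0 : (0:ℝ) ∈ Icc 0 L := ⟨le_rfl, hL⟩
  have ms : s ∈ Icc 0 L := ⟨hs, hst.trans ht⟩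
  have mt : t ∈ Icc 0 L := ⟨hs.trans hst, ht⟩
  have mL : L ∈ Icc 0 L := ⟨hL, le_rfl⟩
  have e₁ := intervalIntegral.integral_add_adjacent_intervals (i m0 ms) (i ms mt)
  have e₂ := intervalIntegral.integral_add_adjacent_intervals (i m0 mt) (i mt mL)
  have k₁ := quasihyperbolic_le_integral hpos hγ le_rfl hs ms.2
  have k₂ := quasihyperbolic_le_integral hpos hγ mt.1 ht le_rfl
  have t₁ := quasihyperbolic_triangle hpos hunif (γ 0) (γ s) (γ L)
  have t₂ := quasihyperbolic_triangle hpos hunif (γ s) (γ t) (γ L)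
  linarith

lemma IsNearGeodesic.quasihyperbolic_add_le (hpos : ∀ x : X, 0 < distToBdry X x)
    {γ : ℝ → X} {L t : ℝ} (hγ : IsNearGeodesic γ L) (ht : t ∈ Icc 0 L) :
    quasihyperbolic X (γ 0) (γ t) + quasihyperbolic X (γ t) (γ L) ≤
      quasihyperbolic X (γ 0) (γ L) + 1 := by
  have hL : 0 ≤ L := ht.1.trans ht.2
  have e := intervalIntegral.integral_add_adjacent_intervals
    (intervalIntegrable_inv_distToBdry hpos hγ.1 ⟨le_rfl, hL⟩ ht)
    (intervalIntegrable_inv_distToBdry hpos hγ.1 ht ⟨hL, le_rfl⟩)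
  linarith [quasihyperbolic_le_integral hpos hγ.1 le_rfl ht.1 ht.2,
    quasihyperbolic_le_integral hpos hγ.1 ht.1 ht.2 le_rfl, hγ.2 0 L le_rfl hL le_rfl]

lemma IsNearGeodesic.reverse (hpos : ∀ x : X, 0 < distToBdry X x) {A : ℝ}
    (hunif : IsUniformMS X A) {γ : ℝ → X} {L : ℝ} (hγ : IsNearGeodesic γ L) :
    IsNearGeodesic (fun t => γ (L - t)) L := by
  refine ⟨hγ.1.comp_const_sub, fun s t hs hst ht => ?_⟩
  rw [intervalIntegral.integral_comp_sub_left (fun r => (distToBdry X (γ r))⁻¹),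
    quasihyperbolic_comm hpos hunif]
  exact hγ.2 _ _ (by linarith) (by linarith) (by linarith)

lemma integral_inv_add_two_mul {m L : ℝ} (hm : 0 < m) (hL : 0 ≤ L) :
    ∫ t in (0:ℝ)..L, (m + 2 * t)⁻¹ = Real.log (1 + 2 * L / m) / 2 := by
  rw [intervalIntegral.integral_comp_add_mul (fun t => t⁻¹) two_ne_zero,
    integral_inv_of_pos (by linarith) (by linarith)]
  simp only [mul_zero, add_zero, smul_eq_mul]
  rw [add_div, div_self hm.ne']
  ring

lemma quasihyperbolic_le_log (hpos : ∀ x : X, 0 < distToBdry X x) {A : ℝ} (hA : 1 ≤ A)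
    (hunif : IsUniformMS X A) {x y : X} {m : ℝ} (hm : 0 < m)
    (hx : m ≤ distToBdry X x) (hy : m ≤ distToBdry X y) :
    quasihyperbolic X x y ≤ 4 * A ^ 2 * Real.log (1 + 2 * A * dist x y / m) := by
  obtain ⟨L, hL, γ, hγ, rfl, rfl, hLA, hmin⟩ := hunif x y
  have cont : ContinuousOn (fun t : ℝ => (m + 2 * t)⁻¹) (Icc 0 L) := by
    refine ContinuousOn.inv₀ (by fun_prop) fun t ht => ?_
    have := ht.1
    positivity
  have cont' : ContinuousOn (fun t : ℝ => (m + 2 * (L - t))⁻¹) (Icc 0 L) := by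
    refine ContinuousOn.inv₀ (by fun_prop) fun t ht => ?_
    have := sub_nonneg.2 ht.2
    positivity
  have i₁ := ContinuousOn.intervalIntegrable (μ := MeasureTheory.volume) (u := fun t : ℝ =>
    (m + 2 * t)⁻¹) (a := 0) (b := L) (by rwa [uIcc_of_le hL])
  have i₂ := ContinuousOn.intervalIntegrable (μ := MeasureTheory.volume) (u := fun t : ℝ =>
    (m + 2 * (L - t))⁻¹) (a := 0) (b := L) (by rwa [uIcc_of_le hL])
  have hbound : ∀ t ∈ Icc 0 L, (distToBdry X (γ t))⁻¹ ≤
      (1 + 3 * A) * ((m + 2 * t)⁻¹ + (m + 2 * (L - t))⁻¹) := by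
    intro t ht
    have h0 : 0 ≤ L - t := sub_nonneg.2 ht.2
    have h0' := ht.1
    have hd := hpos (γ t)
    have p₁ : 0 < (m + 2 * t)⁻¹ := by positivity
    have p₂ : 0 < (m + 2 * (L - t))⁻¹ := by positivity
    have aux : ∀ r : ℝ, 0 ≤ r → r ≤ A * distToBdry X (γ t) → m ≤ distToBdry X (γ t) + r →
        (distToBdry X (γ t))⁻¹ ≤ (1 + 3 * A) * (m + 2 * r)⁻¹ := by
      intro r hr h₁ h₂
      rw [← div_eq_mul_inv, le_div_iff₀ (by positivity), inv_mul_le_iff₀ hd]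
      nlinarith
    have l₁ := dist_le_of_lipschitzOnWith_one hγ le_rfl ht.1 ht.2
    have l₂ := dist_le_of_lipschitzOnWith_one hγ ht.1 ht.2 le_rfl
    have b₁ := distToBdry_le_add_dist (γ 0) (γ t)
    have b₂ := distToBdry_le_add_dist (γ L) (γ t)
    rw [dist_comm] at b₂
    rcases min_le_iff.1 (hmin t ht) with h | h
    · have := aux t h0' h (by linarith)
      nlinarith
    · have := aux (L - t) h0 h (by linarith)
      nlinarith
  have hint := intervalIntegral.integral_mono_on hL
    (intervalIntegrable_inv_distToBdry hpos hγ ⟨le_rfl, hL⟩ ⟨hL, le_rfl⟩)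
    ((i₁.add i₂).const_mul (1 + 3 * A)) hbound
  rw [intervalIntegral.integral_const_mul, intervalIntegral.integral_add i₁ i₂,
    intervalIntegral.integral_comp_sub_left (fun t => (m + 2 * t)⁻¹), sub_self, sub_zero,
    integral_inv_add_two_mul hm hL] at hint
  have hlog0 : 0 ≤ Real.log (1 + 2 * L / m) :=
    Real.log_nonneg (by have : 0 ≤ 2 * L / m := by positivity
                        linarith)
  have hlog : Real.log (1 + 2 * L / m) ≤ Real.log (1 + 2 * A * dist (γ 0) (γ L) / m) := by
    refine Real.log_le_log (by positivity) ?_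
    gcongr 1 + ?_ / m
    linarith
  have hk := quasihyperbolic_le_of_curve hpos hL hγ
  have hA' : 1 + 3 * A ≤ 4 * A ^ 2 := by nlinarith
  calc quasihyperbolic X (γ 0) (γ L) ≤ (1 + 3 * A) * Real.log (1 + 2 * L / m) := by linarith
    _ ≤ 4 * A ^ 2 * Real.log (1 + 2 * A * dist (γ 0) (γ L) / m) := by gcongr

/-- A bound, in units of height, for the length of a near-geodesic between two consecutive dyadic
heights. -/
def stepConst (A : ℝ) : ℝ := 2 + 8 * A ^ 2 * Real.log (32 * A ^ 3)

lemma two_le_stepConst {A : ℝ} (hA : 1 ≤ A) : 2 ≤ stepConst A := by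
  have : 0 ≤ Real.log (32 * A ^ 3) :=
    Real.log_nonneg (by nlinarith [one_le_pow₀ hA (n := 3)])
  have : 0 ≤ 8 * A ^ 2 * Real.log (32 * A ^ 3) := by positivity
  unfold stepConst
  linarith

lemma le_stepConst {A a : ℝ} (hA : 1 ≤ A) (ha : 0 ≤ a)
    (h : a ≤ 1 + 4 * A ^ 2 * Real.log (1 + 4 * A * a)) : a ≤ stepConst A := by
  have hA0 : 0 < A := by linarith
  have hM : 0 < 32 * A ^ 3 := by positivity
  have h1 : 1 ≤ 32 * A ^ 3 := by nlinarith [one_le_pow₀ hA (n := 3)]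
  have hlog : Real.log (1 + 4 * A * a) ≤ Real.log (32 * A ^ 3) + 4 * A * a / (32 * A ^ 3) := by
    have e := Real.log_le_sub_one_of_pos (x := (1 + 4 * A * a) / (32 * A ^ 3)) (by positivity)
    rw [Real.log_div (by positivity) (by positivity), add_div] at e
    have : 1 / (32 * A ^ 3) ≤ 1 := by rwa [div_le_one hM]
    linarith
  have e : 4 * A ^ 2 * (4 * A * a / (32 * A ^ 3)) = a / 2 := by
    field_simp
    ring
  have := mul_le_mul_of_nonneg_left hlog (by positivity : 0 ≤ 4 * A ^ 2)
  rw [mul_add, e] at this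
  unfold stepConst
  linarith

lemma IsNearGeodesic.dist_le_of_half_le (hpos : ∀ x : X, 0 < distToBdry X x) {A : ℝ}
    (hA : 1 ≤ A) (hunif : IsUniformMS X A) {γ : ℝ → X} {L : ℝ} (hγ : IsNearGeodesic γ L)
    {s t D : ℝ} (hD : 0 < D) (hs : 0 ≤ s) (hst : s ≤ t) (ht : t ≤ L)
    (hle : ∀ r ∈ Icc s t, distToBdry X (γ r) ≤ D)
    (hs' : D / 2 ≤ distToBdry X (γ s)) (ht' : D / 2 ≤ distToBdry X (γ t)) :
    dist (γ s) (γ t) ≤ stepConst A * D := by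
  have hdist := dist_le_of_lipschitzOnWith_one hγ.1 hs hst ht
  have hlow : (t - s) / D ≤ ∫ r in s..t, (distToBdry X (γ r))⁻¹ := by
    have := intervalIntegral.integral_mono_on hst
      (intervalIntegrable_const (c := D⁻¹) (μ := MeasureTheory.volume))
      (intervalIntegrable_inv_distToBdry hpos hγ.1 ⟨hs, hst.trans ht⟩ ⟨hs.trans hst, ht⟩)
      (fun r hr => inv_anti₀ (hpos _) (hle r hr))
    simpa [div_eq_mul_inv] using this
  have hup := quasihyperbolic_le_log hpos hA hunif (half_pos hD) hs' ht'
  have hng := hγ.2 s t hs hst ht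
  have ha : dist (γ s) (γ t) / D ≤ stepConst A := by
    refine le_stepConst hA (by positivity) ?_
    have e : 2 * A * dist (γ s) (γ t) / (D / 2) = 4 * A * (dist (γ s) (γ t) / D) := by
      field_simp
      ring
    rw [e] at hup
    have : dist (γ s) (γ t) / D ≤ (t - s) / D := by gcongr
    linarith
  rwa [div_le_iff₀ hD] at ha

lemma exists_first_height {γ : ℝ → X} {L T h : ℝ} (hγ : LipschitzOnWith 1 γ (Icc 0 L))
    (hT : T ∈ Icc 0 L) (h0 : distToBdry X (γ 0) ≤ h) (hh : h ≤ distToBdry X (γ T)) :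
    ∃ t ∈ Icc 0 T, distToBdry X (γ t) = h ∧ ∀ r ∈ Icc 0 t, distToBdry X (γ r) ≤ h := by
  have hsub : Icc 0 T ⊆ Icc 0 L := Icc_subset_Icc_right hT.2
  have hc : ContinuousOn (fun t => distToBdry X (γ t)) (Icc 0 T) :=
    continuous_distToBdry.comp_continuousOn (hγ.continuousOn.mono hsub)
  have hcomp : IsCompact (Icc 0 T ∩ (fun t => distToBdry X (γ t)) ⁻¹' {h}) :=
    isCompact_Icc.of_isClosed_subset (hc.preimage_isClosed_of_isClosed isClosed_Icc
      isClosed_singleton) inter_subset_left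
  obtain ⟨t₀, ht₀, ht₀h⟩ := intermediate_value_Icc hT.1 hc ⟨h0, hh⟩
  obtain ⟨t, ⟨ht, hth⟩, hmin⟩ := hcomp.exists_isLeast ⟨t₀, ht₀, ht₀h⟩
  refine ⟨t, ht, hth, fun r hr => ?_⟩
  by_contra! hlt
  have hrT : r ∈ Icc 0 T := ⟨hr.1, hr.2.trans ht.2⟩
  obtain ⟨r', hr', hr'h⟩ := intermediate_value_Icc hr.1
    (hc.mono (Icc_subset_Icc_right hrT.2)) ⟨h0, hlt.le⟩
  have hle : t ≤ r' := hmin ⟨⟨hr'.1, hr'.2.trans hrT.2⟩, hr'h⟩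
  have : r = r' := le_antisymm (hr.2.trans hle) hr'.2
  subst this
  simp only at hr'h
  linarith

lemma IsNearGeodesic.dist_le_of_isMaxOn (hpos : ∀ x : X, 0 < distToBdry X x) {A : ℝ}
    (hA : 1 ≤ A) (hunif : IsUniformMS X A) {γ : ℝ → X} {L : ℝ} (hγ : IsNearGeodesic γ L)
    {T : ℝ} (hT : T ∈ Icc 0 L) (hmax : ∀ r ∈ Icc 0 T, distToBdry X (γ r) ≤ distToBdry X (γ T)) :
    dist (γ 0) (γ T) ≤ 2 * stepConst A * distToBdry X (γ T) := by
  have key : ∀ n : ℕ, ∀ T ∈ Icc 0 L,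
      (∀ r ∈ Icc 0 T, distToBdry X (γ r) ≤ distToBdry X (γ T)) →
      distToBdry X (γ T) ≤ 2 ^ (n + 1) * distToBdry X (γ 0) →
      dist (γ 0) (γ T) ≤ 2 * stepConst A * distToBdry X (γ T) := by
    have hstep := two_le_stepConst hA
    have near : ∀ T ∈ Icc 0 L,
        (∀ r ∈ Icc 0 T, distToBdry X (γ r) ≤ distToBdry X (γ T)) →
        distToBdry X (γ T) / 2 ≤ distToBdry X (γ 0) →
        dist (γ 0) (γ T) ≤ 2 * stepConst A * distToBdry X (γ T) := by
      intro T hT hmax hn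
      have hD := hpos (γ T)
      have := hγ.dist_le_of_half_le hpos hA hunif hD le_rfl hT.1 hT.2 hmax hn (by linarith)
      nlinarith
    intro n
    induction n with
    | zero =>
      intro T hT hmax hn
      exact near T hT hmax (by rw [zero_add, pow_one] at hn; linarith)
    | succ n ih =>
      intro T hT hmax hn
      have hD := hpos (γ T)
      rcases le_total (distToBdry X (γ T) / 2) (distToBdry X (γ 0)) with h | h
      · exact near T hT hmax h
      · obtain ⟨t, ht, hth, hle⟩ := exists_first_height hγ.1 hT h (by linarith)
        have htL : t ∈ Icc 0 L := ⟨ht.1, ht.2.trans hT.2⟩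
        have d₁ := ih t htL (by rwa [hth]) (by rw [hth]; rw [pow_succ] at hn; linarith)
        have d₂ := hγ.dist_le_of_half_le hpos hA hunif hD ht.1 ht.2 hT.2
          (fun r hr => hmax r ⟨ht.1.trans hr.1, hr.2⟩) hth.ge (by linarith)
        rw [hth] at d₁
        linarith [dist_triangle (γ 0) (γ t) (γ T)]
  obtain ⟨n, hn⟩ := pow_unbounded_of_one_lt (distToBdry X (γ T) / distToBdry X (γ 0))
    (one_lt_two (α := ℝ))
  refine key n T hT hmax ?_
  rw [div_lt_iff₀ (hpos _)] at hn
  rw [pow_succ]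
  nlinarith [hpos (γ T)]

lemma IsNearGeodesic.exists_high_point (hpos : ∀ x : X, 0 < distToBdry X x) {A : ℝ}
    (hA : 1 ≤ A) (hunif : IsUniformMS X A) {γ : ℝ → X} {L σ : ℝ} (hL : 0 ≤ L)
    (hγ : IsNearGeodesic γ L) (hσ : 0 < σ) (hσ' : σ ≤ dist (γ 0) (γ L)) :
    ∃ t ∈ Icc 0 L, σ / (4 * stepConst A) ≤ distToBdry X (γ t) ∧ dist (γ 0) (γ t) ≤ σ / 2 := by
  have ha : 0 < stepConst A := by linarith [two_le_stepConst hA]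
  rcases le_total (σ / (4 * stepConst A)) (distToBdry X (γ 0)) with h0 | h0
  · exact ⟨0, ⟨le_rfl, hL⟩, h0, by rw [dist_self]; positivity⟩
  obtain ⟨T, hT, hmax⟩ := isCompact_Icc.exists_isMaxOn (nonempty_Icc.2 hL)
    (continuous_distToBdry.comp_continuousOn hγ.1.continuousOn)
  replace hmax : ∀ r ∈ Icc 0 L, distToBdry X (γ r) ≤ distToBdry X (γ T) := fun r hr => hmax hr
  have hhigh : σ / (4 * stepConst A) ≤ distToBdry X (γ T) := by
    have d₁ := hγ.dist_le_of_isMaxOn hpos hA hunif hT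
      fun r hr => hmax r ⟨hr.1, hr.2.trans hT.2⟩
    have d₂ := (hγ.reverse hpos hunif).dist_le_of_isMaxOn hpos hA hunif (T := L - T)
      ⟨by linarith [hT.2], by linarith [hT.1]⟩
      (by
        intro r hr
        rw [sub_sub_cancel]
        exact hmax _ ⟨by linarith [hr.2, hT.1], by linarith [hr.1]⟩)
    simp only [sub_zero, sub_sub_cancel] at d₂
    rw [div_le_iff₀ (by positivity)]
    have := dist_triangle_right (γ 0) (γ L) (γ T)
    linarith
  obtain ⟨t, ht, hth, hle⟩ := exists_first_height hγ.1 hT h0 hhigh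
  have htL : t ∈ Icc 0 L := ⟨ht.1, ht.2.trans hT.2⟩
  refine ⟨t, htL, hth.ge, ?_⟩
  have d := hγ.dist_le_of_isMaxOn hpos hA hunif htL (by rwa [hth])
  rw [hth] at d
  refine d.trans_eq ?_
  field_simp
  ring

end QuasihyperbolicMetric

/-- Gromov product difference estimate, case t ≥ 1. -/
theorem gromovProd_difference_estimate_case_one (A : ℝ) (hA : 1 ≤ A) :
    ∃ B C : ℝ, 1 ≤ B ∧ 0 ≤ C ∧
      ∀ (X : Type u) [MetricSpace X], IsUnbounded X → IsUniformMS X A →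
        (∀ x : X, 0 < distToBdry X x) →
        ∀ x y z u : X,
          max (dist x y) (dist x z) ≤ (1 / 2) * dist x u →
          0 < (1 / 2) * dist x z → (1 / 2) * dist x z ≤ dist x y →
          gromovProd (quasihyperbolic X) u x z -
              gromovProd (quasihyperbolic X) u x y ≤
            4 * A ^ 2 * Real.log (1 + 6 * B * dist x y / dist x z) + C := by
  have ha := two_le_stepConst hA
  refine ⟨8 * stepConst A * A, 1, by nlinarith, zero_le_one, ?_⟩
  intro X _ _ hunif hpos x y z u hmax hxz hle
  have hxy' : dist x y ≤ 1 / 2 * dist x u := (le_max_left _ _).trans hmax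
  have hs : 0 < dist x z := by linarith
  have hr : 0 < dist x y := by linarith
  obtain ⟨L₁, hL₁, γ₁, hγ₁, hx₁, hz₁⟩ := exists_isNearGeodesic hpos hunif x z
  obtain ⟨L₂, hL₂, γ₂, hγ₂, hy₂, hu₂⟩ := exists_isNearGeodesic hpos hunif y u
  obtain ⟨t₁, ht₁, hq, hxq⟩ := hγ₁.exists_high_point hpos hA hunif hL₁ hs (by rw [hx₁, hz₁])
  obtain ⟨t₂, ht₂, hp, hyp⟩ := hγ₂.exists_high_point hpos hA hunif hL₂ hr
    (by rw [hy₂, hu₂]; linarith [dist_triangle x y u])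
  have k₁ := hγ₁.quasihyperbolic_add_le hpos ht₁
  have k₂ := hγ₂.quasihyperbolic_add_le hpos ht₂
  rw [hx₁] at hxq
  rw [hy₂] at hyp
  rw [hx₁, hz₁] at k₁
  rw [hy₂, hu₂] at k₂
  generalize γ₁ t₁ = q at *
  generalize γ₂ t₂ = p at *
  have hm : 0 < dist x z / (8 * stepConst A) := by positivity
  have hmq : dist x z / (8 * stepConst A) ≤ distToBdry X q := by
    refine le_trans ?_ hq
    gcongr
    norm_num
  have hmp : dist x z / (8 * stepConst A) ≤ distToBdry X p := by
    refine le_trans ?_ hp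
    rw [div_le_div_iff₀ (by positivity) (by positivity)]
    nlinarith
  have hqp := quasihyperbolic_le_log hpos hA hunif hm hmq hmp
  have hd : dist q p ≤ 3 * dist x y := by
    have := dist_triangle4 q x y p
    rw [dist_comm q x] at this
    linarith
  have hlog : Real.log (1 + 2 * A * dist q p / (dist x z / (8 * stepConst A))) ≤
      Real.log (1 + 6 * (8 * stepConst A * A) * dist x y / dist x z) := by
    refine Real.log_le_log (by positivity) ?_
    have e : 6 * (8 * stepConst A * A) * dist x y / dist x z =
        2 * A * (3 * dist x y) / (dist x z / (8 * stepConst A)) := by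
      field_simp
      ring
    rw [e]
    gcongr
  have hfin : quasihyperbolic X q p ≤
      4 * A ^ 2 * Real.log (1 + 6 * (8 * stepConst A * A) * dist x y / dist x z) :=
    hqp.trans (by gcongr)
  have t₁ := quasihyperbolic_triangle hpos hunif z q u
  have t₂ := quasihyperbolic_triangle hpos hunif q p u
  have t₃ := quasihyperbolic_triangle hpos hunif x p y
  have t₄ := quasihyperbolic_triangle hpos hunif x q p
  rw [quasihyperbolic_comm hpos hunif z q] at t₁
  rw [quasihyperbolic_comm hpos hunif p y] at t₃
  unfold gromovProd
  linarith

end
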